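/- arXiv:1808.07646 — 12 statements merged into one kernel-verified Lean document; each statement's English description precedes it below -/
import Mathlib

section
/- Let φ, ψ : [0,1] → ℝ satisfy conditions (F1)–(F3). Define f(u) = φ(u) − u for u ∈ [0,1] and g(v) = 1 − v − ψ(1 − v) for v ∈ [0,1]. Then the pair (f, g) satisfies conditions (G1)–(G3). -/
/-- Conditions (G1)–(G3) for a pair of generators of a reflected maxmin copula:
(G1) `f` and `g` are nonnegative on `[0,1]` and vanish at `0` and `1`;
(G2) `u ↦ f u + u` and `v ↦ g v + v` are nondecreasing on `[0,1]`;
(G3) `u ↦ f u / u` and `v ↦ g v / v` are nonincreasing on `(0,1]`. -/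
def CondG (f g : ℝ → ℝ) : Prop :=
  (∀ u ∈ Set.Icc (0:ℝ) 1, 0 ≤ f u) ∧ (∀ v ∈ Set.Icc (0:ℝ) 1, 0 ≤ g v) ∧
  f 0 = 0 ∧ g 0 = 0 ∧ f 1 = 0 ∧ g 1 = 0 ∧
  (∀ u₁ ∈ Set.Icc (0:ℝ) 1, ∀ u₂ ∈ Set.Icc (0:ℝ) 1, u₁ ≤ u₂ → f u₁ + u₁ ≤ f u₂ + u₂) ∧
  (∀ v₁ ∈ Set.Icc (0:ℝ) 1, ∀ v₂ ∈ Set.Icc (0:ℝ) 1, v₁ ≤ v₂ → g v₁ + v₁ ≤ g v₂ + v₂) ∧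
  (∀ u₁ ∈ Set.Ioc (0:ℝ) 1, ∀ u₂ ∈ Set.Ioc (0:ℝ) 1, u₁ ≤ u₂ → f u₂ / u₂ ≤ f u₁ / u₁) ∧
  (∀ v₁ ∈ Set.Ioc (0:ℝ) 1, ∀ v₂ ∈ Set.Ioc (0:ℝ) 1, v₁ ≤ v₂ → g v₂ / v₂ ≤ g v₁ / v₁)
/-- Conditions (F1)–(F3) for the generators of a maxmin copula:
(F1) `φ 0 = ψ 0 = 0` and `φ 1 = ψ 1 = 1`;
(F2) `φ` and `ψ` are nondecreasing on `[0,1]`;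
(F3) `φ u ≥ u` on `[0,1]` and `u ↦ φ u / u` is nonincreasing on `(0,1]`;
`ψ v ≤ v` on `(0,1)` and `v ↦ (1 - ψ v)/(v - ψ v)` is nonincreasing on `(0,1)`
in the extended sense `(1 - ψ v₁) * (v₂ - ψ v₂) ≥ (1 - ψ v₂) * (v₁ - ψ v₁)`. -/
def CondF (φ ψ : ℝ → ℝ) : Prop :=
  φ 0 = 0 ∧ ψ 0 = 0 ∧ φ 1 = 1 ∧ ψ 1 = 1 ∧
  (∀ u₁ ∈ Set.Icc (0:ℝ) 1, ∀ u₂ ∈ Set.Icc (0:ℝ) 1, u₁ ≤ u₂ → φ u₁ ≤ φ u₂) ∧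
  (∀ v₁ ∈ Set.Icc (0:ℝ) 1, ∀ v₂ ∈ Set.Icc (0:ℝ) 1, v₁ ≤ v₂ → ψ v₁ ≤ ψ v₂) ∧
  (∀ u ∈ Set.Icc (0:ℝ) 1, u ≤ φ u) ∧
  (∀ u₁ ∈ Set.Ioc (0:ℝ) 1, ∀ u₂ ∈ Set.Ioc (0:ℝ) 1, u₁ ≤ u₂ → φ u₂ / u₂ ≤ φ u₁ / u₁) ∧
  (∀ v ∈ Set.Ioo (0:ℝ) 1, ψ v ≤ v) ∧
  (∀ v₁ v₂ : ℝ, 0 < v₁ → v₁ ≤ v₂ → v₂ < 1 →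
    (1 - ψ v₂) * (v₁ - ψ v₁) ≤ (1 - ψ v₁) * (v₂ - ψ v₂))

/-- If `(φ, ψ)` satisfies (F1)–(F3), then `f u = φ u - u` and `g v = 1 - v - ψ (1 - v)`
satisfy (G1)–(G3). -/
theorem maxmin_generators_give_rmm_generators (φ ψ : ℝ → ℝ) (h : CondF φ ψ) :
    CondG (fun u => φ u - u) (fun v => 1 - v - ψ (1 - v)) := by
  obtain ⟨hφ0, hψ0, hφ1, hψ1, hφ_mono, hψ_mono, hφ_ge, hφ_div, hψ_le, hψ_cross⟩ := h
  have hg_nonneg : ∀ v ∈ Set.Icc (0:ℝ) 1, 0 ≤ 1 - v - ψ (1 - v) := by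
    rintro v ⟨hv0, hv1⟩
    rcases hv0.eq_or_lt with rfl | hv0
    · simp [hψ1]
    rcases hv1.eq_or_lt with rfl | hv1
    · simp [hψ0]
    exact sub_nonneg.2 (hψ_le (1 - v) ⟨by linarith, by linarith⟩)
  refine ⟨fun u hu => sub_nonneg.2 (hφ_ge u hu), hg_nonneg, by simp [hφ0], by simp [hψ1],
    by simp [hφ1], by simp [hψ0], ?_, ?_, ?_, ?_⟩
  · intro u₁ h₁ u₂ h₂ h₁₂
    simpa using hφ_mono u₁ h₁ u₂ h₂ h₁₂
  · rintro v₁ ⟨h₁0, h₁1⟩ v₂ ⟨h₂0, h₂1⟩ h₁₂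
    have := hψ_mono (1 - v₂) ⟨by linarith, by linarith⟩ (1 - v₁) ⟨by linarith, by linarith⟩
      (by linarith)
    dsimp only
    linarith
  · intro u₁ h₁ u₂ h₂ h₁₂
    have := hφ_div u₁ h₁ u₂ h₂ h₁₂
    dsimp only
    rw [sub_div, sub_div, div_self h₁.1.ne', div_self h₂.1.ne']
    linarith
  · intro v₁ h₁ v₂ h₂ h₁₂
    dsimp only
    rcases h₂.2.eq_or_lt with rfl | h₂1
    · simpa [hψ0] using div_nonneg (hg_nonneg v₁ ⟨h₁.1.le, h₁.2⟩) h₁.1.le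
    have := hψ_cross (1 - v₂) (1 - v₁) (by linarith) (by linarith) (by linarith [h₁.1])
    rw [div_le_div_iff₀ h₂.1 h₁.1]
    linarith
end

section
/- Let f, g : [0,1] → ℝ be a pair satisfying conditions (G1)–(G3). Define φ(u) = u + f(u) for u ∈ [0,1] and ψ(v) = v − g(1 − v) for v ∈ [0,1]. Then the pair (φ, ψ) satisfies conditions (F1)–(F3). -/
/-- If `(f, g)` satisfies (G1)–(G3), then `φ u = u + f u` and `ψ v = v - g (1 - v)`
satisfy (F1)–(F3). -/
theorem rmm_generators_give_maxmin_generators (f g : ℝ → ℝ) (h : CondG f g) :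
    CondF (fun u => u + f u) (fun v => v - g (1 - v)) := by
  obtain ⟨hf, hg, hf0, hg0, hf1, hg1, hfm, hgm, hfd, hgd⟩ := h
  refine ⟨by simp [hf0], by simp [hg1], by simp [hf1], by simp [hg0], ?_, ?_, ?_, ?_, ?_, ?_⟩
  · intro u₁ hu₁ u₂ hu₂ hu
    linarith [hfm u₁ hu₁ u₂ hu₂ hu]
  · rintro v₁ ⟨_, _⟩ v₂ ⟨_, _⟩ hv
    have := hgm (1 - v₂) ⟨by linarith, by linarith⟩ (1 - v₁) ⟨by linarith, by linarith⟩
      (by linarith)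
    linarith
  · intro u hu
    linarith [hf u hu]
  · intro u₁ hu₁ u₂ hu₂ hu
    simpa [add_div, hu₁.1.ne', hu₂.1.ne'] using hfd u₁ hu₁ u₂ hu₂ hu
  · rintro v ⟨_, _⟩
    linarith [hg (1 - v) ⟨by linarith, by linarith⟩]
  · intro v₁ v₂ _ _ _
    have := hgd (1 - v₂) ⟨by linarith, by linarith⟩ (1 - v₁) ⟨by linarith, by linarith⟩
      (by linarith)
    rw [div_le_div_iff₀ (by linarith) (by linarith)] at this
    linear_combination this
end

section
/- Let f, g : [0,1] → ℝ be a pair satisfying conditions (G1)–(G3), and define C_{f,g}(u,v) = max{0, uv − f(u)g(v)} for (u,v) ∈ [0,1]². Then C_{f,g} is a bivariate copula: C_{f,g}(u,0) = C_{f,g}(0,v) = 0, C_{f,g}(u,1) = u, C_{f,g}(1,v) = v for all u, v ∈ [0,1], and C_{f,g}(u₂,v₂) − C_{f,g}(u₂,v₁) − C_{f,g}(u₁,v₂) + C_{f,g}(u₁,v₁) ≥ 0 whenever 0 ≤ u₁ ≤ u₂ ≤ 1 and 0 ≤ v₁ ≤ v₂ ≤ 1. -/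
/-- Truncated differences `max 0 (u * v - a * b)` increase along a segment on which the ratio `b / v`
decreases. -/
lemma truncated_mono {u a v₁ v₂ b₁ b₂ : ℝ} (ha : 0 ≤ a) (hv₁ : 0 < v₁) (hv : v₁ ≤ v₂)
    (hb : b₂ * v₁ ≤ b₁ * v₂) : max 0 (u * v₁ - a * b₁) ≤ max 0 (u * v₂ - a * b₂) := by
  rcases le_total (u * v₁ - a * b₁) 0 with hD | hD
  · rw [max_eq_left hD]
    exact le_max_left _ _
  · rw [max_eq_right hD]
    refine le_trans ?_ (le_max_right _ _)
    refine le_of_mul_le_mul_left ?_ hv₁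
    nlinarith [mul_le_mul_of_nonneg_left hb ha, mul_le_mul_of_nonneg_right hv hD]

/-- If each of `a`, `b` decreases at most as fast as the identity and `a / u`, `b / v` decrease, then
increments of `a`, `b` satisfy the rectangle inequality as long as they do not both increase or
`a₁ * b₁ ≤ u₁ * v₁`. -/
lemma mul_increments_le {u₁ u₂ v₁ v₂ a₁ a₂ b₁ b₂ : ℝ} (hu₁ : 0 < u₁) (hu : u₁ ≤ u₂)
    (hv₁ : 0 < v₁) (hv : v₁ ≤ v₂) (ha : a₁ + u₁ ≤ a₂ + u₂) (hb : b₁ + v₁ ≤ b₂ + v₂)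
    (hau : a₂ * u₁ ≤ a₁ * u₂) (hbv : b₂ * v₁ ≤ b₁ * v₂)
    (h : a₁ ≤ a₂ → b₁ ≤ b₂ → a₁ * b₁ ≤ u₁ * v₁) :
    (a₂ - a₁) * (b₂ - b₁) ≤ (u₂ - u₁) * (v₂ - v₁) := by
  have hU : 0 ≤ (u₂ - u₁) * (v₂ - v₁) := mul_nonneg (sub_nonneg.2 hu) (sub_nonneg.2 hv)
  rcases le_total a₁ a₂ with ha' | ha' <;> rcases le_total b₁ b₂ with hb' | hb'
  · have h1 : (a₂ - a₁) * u₁ ≤ a₁ * (u₂ - u₁) := by linarith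
    have h2 : (b₂ - b₁) * v₁ ≤ b₁ * (v₂ - v₁) := by linarith
    have h3 := mul_le_mul h1 h2 (mul_nonneg (sub_nonneg.2 hb') hv₁.le)
      ((mul_nonneg (sub_nonneg.2 ha') hu₁.le).trans h1)
    have h4 := mul_le_mul_of_nonneg_right (h ha' hb') hU
    refine le_of_mul_le_mul_left ?_ (mul_pos hu₁ hv₁)
    linarith
  · exact (mul_nonpos_of_nonneg_of_nonpos (sub_nonneg.2 ha') (sub_nonpos.2 hb')).trans hU
  · exact (mul_nonpos_of_nonpos_of_nonneg (sub_nonpos.2 ha') (sub_nonneg.2 hb')).trans hU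
  · nlinarith [mul_le_mul (show a₁ - a₂ ≤ u₂ - u₁ by linarith) (show b₁ - b₂ ≤ v₂ - v₁ by linarith)
      (sub_nonneg.2 hb') (sub_nonneg.2 hu)]

/-- The rectangle inequality when the lower left corner is truncated and both `a`, `b` increase. -/
lemma rectangle_of_truncated_corner {u₁ u₂ v₁ v₂ a₁ a₂ b₁ b₂ : ℝ}
    (hu₁ : 0 < u₁) (hv₁ : 0 < v₁) (ha₁ : 0 ≤ a₁) (hb₁ : 0 ≤ b₁)
    (hau : a₂ * u₁ ≤ a₁ * u₂) (hbv : b₂ * v₁ ≤ b₁ * v₂) (ha : a₁ ≤ a₂) (hb : b₁ ≤ b₂)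
    (h₁₁ : u₁ * v₁ < a₁ * b₁) (h₂₁ : a₂ * b₁ ≤ u₂ * v₁) (h₁₂ : a₁ * b₂ ≤ u₁ * v₂) :
    (u₂ * v₁ - a₂ * b₁) + (u₁ * v₂ - a₁ * b₂) ≤ u₂ * v₂ - a₂ * b₂ := by
  have hab : 0 < a₁ * b₁ := (mul_pos hu₁ hv₁).trans h₁₁
  have ha₁' : 0 < a₁ := pos_of_mul_pos_left hab hb₁
  have hb₁' : 0 < b₁ := pos_of_mul_pos_right hab ha₁
  obtain ⟨p, rfl⟩ : ∃ p, u₁ = a₁ * p := ⟨u₁ / a₁, by field_simp⟩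
  obtain ⟨q, rfl⟩ : ∃ q, v₁ = b₁ * q := ⟨v₁ / b₁, by field_simp⟩
  have hpq : p * q ≤ 1 := by
    refine le_of_mul_le_mul_left ?_ hab
    linarith
  have hp : a₂ * p ≤ u₂ := le_of_mul_le_mul_left (by linarith) ha₁'
  have hq : b₂ * q ≤ v₂ := le_of_mul_le_mul_left (by linarith) hb₁'
  have h1 : b₂ ≤ p * v₂ := le_of_mul_le_mul_left (by linarith) ha₁'
  have h2 : a₂ ≤ u₂ * q := le_of_mul_le_mul_left (by linarith) hb₁'
  nlinarith [mul_nonneg (sub_nonneg.2 hp) (sub_nonneg.2 hq),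
    mul_nonneg (sub_nonneg.2 ha) (sub_nonneg.2 h1), mul_nonneg (sub_nonneg.2 hb) (sub_nonneg.2 h2),
    mul_nonneg (mul_nonneg (ha₁.trans ha) (hb₁.trans hb)) (sub_nonneg.2 hpq)]

/-- The rectangle inequality for `max 0 (u * v - a * b)` on rectangles away from the axes. -/
lemma rectangle_truncated {u₁ u₂ v₁ v₂ a₁ a₂ b₁ b₂ : ℝ}
    (hu₁ : 0 < u₁) (hu : u₁ ≤ u₂) (hv₁ : 0 < v₁) (hv : v₁ ≤ v₂)
    (ha₁ : 0 ≤ a₁) (ha₂ : 0 ≤ a₂) (hb₁ : 0 ≤ b₁) (hb₂ : 0 ≤ b₂)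
    (ha : a₁ + u₁ ≤ a₂ + u₂) (hb : b₁ + v₁ ≤ b₂ + v₂)
    (hau : a₂ * u₁ ≤ a₁ * u₂) (hbv : b₂ * v₁ ≤ b₁ * v₂) :
    0 ≤ max 0 (u₂ * v₂ - a₂ * b₂) - max 0 (u₂ * v₁ - a₂ * b₁) - max 0 (u₁ * v₂ - a₁ * b₂)
      + max 0 (u₁ * v₁ - a₁ * b₁) := by
  have mv₂ := truncated_mono (u := u₂) ha₂ hv₁ hv hbv
  have mv₁ := truncated_mono (u := u₁) ha₁ hv₁ hv hbv
  have mu₂ := truncated_mono (u := v₂) hb₂ hu₁ hu hau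
  have mu₁ := truncated_mono (u := v₁) hb₁ hu₁ hu hau
  simp only [mul_comm v₂, mul_comm v₁, mul_comm b₂, mul_comm b₁] at mu₁ mu₂
  have p₁₁ := le_max_left 0 (u₁ * v₁ - a₁ * b₁)
  have q₁₁ := le_max_right 0 (u₁ * v₁ - a₁ * b₁)
  have q₂₂ := le_max_right 0 (u₂ * v₂ - a₂ * b₂)
  rcases le_or_gt (u₁ * v₂ - a₁ * b₂) 0 with h₁₂ | h₁₂
  · rw [max_eq_left h₁₂]
    linarith
  rcases le_or_gt (u₂ * v₁ - a₂ * b₁) 0 with h₂₁ | h₂₁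
  · rw [max_eq_left h₂₁]
    linarith
  rw [max_eq_right h₁₂.le, max_eq_right h₂₁.le]
  by_cases h : a₁ ≤ a₂ → b₁ ≤ b₂ → a₁ * b₁ ≤ u₁ * v₁
  · linarith [mul_increments_le hu₁ hu hv₁ hv ha hb hau hbv h]
  · push Not at h
    obtain ⟨ha', hb', h₁₁⟩ := h
    linarith [rectangle_of_truncated_corner hu₁ hv₁ ha₁ hb₁ hau hbv ha' hb' h₁₁
      (by linarith) (by linarith)]

/-- If `(f, g)` satisfies (G1)–(G3), then `C u v = max 0 (u * v - f u * g v)` is a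
bivariate copula: it has the copula boundary values and is 2-increasing. -/
theorem rmm_is_copula (f g : ℝ → ℝ) (h : CondG f g)
    (C : ℝ → ℝ → ℝ) (hC : ∀ u v : ℝ, C u v = max 0 (u * v - f u * g v)) :
    (∀ u ∈ Set.Icc (0:ℝ) 1, C u 0 = 0 ∧ C 0 u = 0 ∧ C u 1 = u ∧ C 1 u = u) ∧
    (∀ u₁ u₂ v₁ v₂ : ℝ, 0 ≤ u₁ → u₁ ≤ u₂ → u₂ ≤ 1 → 0 ≤ v₁ → v₁ ≤ v₂ → v₂ ≤ 1 →
      0 ≤ C u₂ v₂ - C u₂ v₁ - C u₁ v₂ + C u₁ v₁) := by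
  obtain ⟨hf, hg, hf0, hg0, hf1, hg1, hfm, hgm, hfr, hgr⟩ := h
  simp only [hC]
  refine ⟨fun u hu => ?_, fun u₁ u₂ v₁ v₂ hu₁ hu hu₂ hv₁ hv hv₂ => ?_⟩
  · simp [hf0, hg0, hf1, hg1, hu.1]
  have hau : 0 < u₁ → f u₂ * u₁ ≤ f u₁ * u₂ := fun h =>
    (div_le_div_iff₀ (h.trans_le hu) h).1 (hfr u₁ ⟨h, hu.trans hu₂⟩ u₂ ⟨h.trans_le hu, hu₂⟩ hu)
  have hbv : 0 < v₁ → g v₂ * v₁ ≤ g v₁ * v₂ := fun h =>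
    (div_le_div_iff₀ (h.trans_le hv) h).1 (hgr v₁ ⟨h, hv.trans hv₂⟩ v₂ ⟨h.trans_le hv, hv₂⟩ hv)
  have mu₁ : u₁ ∈ Set.Icc (0:ℝ) 1 := ⟨hu₁, hu.trans hu₂⟩
  have mu₂ : u₂ ∈ Set.Icc (0:ℝ) 1 := ⟨hu₁.trans hu, hu₂⟩
  have mv₁ : v₁ ∈ Set.Icc (0:ℝ) 1 := ⟨hv₁, hv.trans hv₂⟩
  have mv₂ : v₂ ∈ Set.Icc (0:ℝ) 1 := ⟨hv₁.trans hv, hv₂⟩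
  rcases hu₁.eq_or_lt with rfl | pu
  · rcases hv₁.eq_or_lt with rfl | pv
    · simp [hf0, hg0]
    · simpa [hf0] using truncated_mono (u := u₂) (hf u₂ mu₂) pv hv (hbv pv)
  · rcases hv₁.eq_or_lt with rfl | pv
    · simpa [hg0, mul_comm] using truncated_mono (u := v₂) (hg v₂ mv₂) pu hu (hau pu)
    · exact rectangle_truncated pu hu pv hv (hf _ mu₁) (hf _ mu₂) (hg _ mv₁) (hg _ mv₂)
        (hfm _ mu₁ _ mu₂ hu) (hgm _ mv₁ _ mv₂ hv) (hau pu) (hbv pv)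
end

section
/- Let f, g : [0,1] → ℝ be a pair satisfying conditions (G1)–(G3), and let C_{f,g}(u,v) = max{0, uv − f(u)g(v)}. Then for all u, v ∈ [0,1], max{0, u + v − 1} ≤ C_{f,g}(u,v) ≤ uv, i.e. every reflected maxmin copula lies between the Fréchet–Hoeffding lower bound W(u,v) = max{0, u + v − 1} and the product copula Π(u,v) = uv; in particular every RMM copula is negatively quadrant dependent. -/
/-- Every reflected maxmin copula lies between the Fréchet–Hoeffding lower bound `W`
and the product copula `Π`; in particular every RMM copula is negatively quadrant
dependent. -/
theorem rmm_between_W_and_Pi (f g : ℝ → ℝ) (h : CondG f g) :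
    ∀ u ∈ Set.Icc (0:ℝ) 1, ∀ v ∈ Set.Icc (0:ℝ) 1,
      max 0 (u + v - 1) ≤ max 0 (u * v - f u * g v) ∧
      max 0 (u * v - f u * g v) ≤ u * v := by
  obtain ⟨hf, hg, -, -, hf1, hg1, hfm, hgm, -, -⟩ := h
  intro u hu v hv
  have one_mem : (1:ℝ) ∈ Set.Icc (0:ℝ) 1 := ⟨zero_le_one, le_rfl⟩
  have hfu : f u ≤ 1 - u := by linarith [hfm u hu 1 one_mem hu.2]
  have hgv : g v ≤ 1 - v := by linarith [hgm v hv 1 one_mem hv.2]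
  have hfg : f u * g v ≤ (1 - u) * (1 - v) :=
    mul_le_mul hfu hgv (hg v hv) (sub_nonneg.2 hu.2)
  refine ⟨max_le_max le_rfl (by linarith), max_le (mul_nonneg hu.1 hv.1) ?_⟩
  exact sub_le_self _ (mul_nonneg (hf u hu) (hg v hv))
end

section
/- Let f, g : [0,1] → ℝ be a pair satisfying conditions (G1)–(G3) and let C(u,v) = max{0, uv − f(u)g(v)}. Suppose moreover that C is a lower semilinear copula, i.e. there exists a function δ : [0,1] → [0,1] such that C(x,y) = y·δ(x)/x whenever 0 < y ≤ x ≤ 1 and C(x,y) = x·δ(y)/y whenever 0 < x ≤ y ≤ 1. Then C(u,v) = uv for all u, v ∈ [0,1], i.e. C is the product copula. -/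
/-- If `u ↦ f u + u` is nondecreasing and `u ↦ f u / u` is nonincreasing, then `u ↦ f u / u` is
continuous away from `0`. -/
theorem continuousOn_div_self_of_monotone_antitone {f : ℝ → ℝ} {m : ℝ} (hm : 0 < m)
    (hf : ∀ u ∈ Set.Icc (0:ℝ) 1, 0 ≤ f u)
    (hmono : ∀ u₁ ∈ Set.Icc (0:ℝ) 1, ∀ u₂ ∈ Set.Icc (0:ℝ) 1, u₁ ≤ u₂ → f u₁ + u₁ ≤ f u₂ + u₂)
    (hanti : ∀ u₁ ∈ Set.Ioc (0:ℝ) 1, ∀ u₂ ∈ Set.Ioc (0:ℝ) 1, u₁ ≤ u₂ → f u₂ / u₂ ≤ f u₁ / u₁) :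
    ContinuousOn (fun u => f u / u) (Set.Icc m 1) := by
  have key : ∀ a ∈ Set.Icc m 1, ∀ b ∈ Set.Icc m 1, a ≤ b →
      |f a / a - f b / b| ≤ (f m / m + 1) / m * (b - a) := by
    intro a ha b hb hab
    have ha0 : 0 < a := hm.trans_le ha.1
    have hb0 : 0 < b := hm.trans_le hb.1
    have h1 := hanti a ⟨ha0, ha.2⟩ b ⟨hb0, hb.2⟩ hab
    have h2 := hanti m ⟨hm, ha.1.trans ha.2⟩ a ⟨ha0, ha.2⟩ ha.1
    have h3 := hmono a ⟨ha0.le, ha.2⟩ b ⟨hb0.le, hb.2⟩ hab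
    have h4 : 0 ≤ f a / a := div_nonneg (hf a ⟨ha0.le, ha.2⟩) ha0.le
    rw [abs_of_nonneg (by linarith)]
    calc f a / a - f b / b ≤ f a / a - (f a - (b - a)) / b := by gcongr; linarith
      _ = (f a / a + 1) * (b - a) / b := by field_simp; ring
      _ ≤ (f m / m + 1) * (b - a) / m := by
        have : 0 ≤ (f m / m + 1) * (b - a) := mul_nonneg (by linarith) (by linarith)
        have : 0 ≤ b - a := by linarith
        gcongr
        exact hb.1
      _ = (f m / m + 1) / m * (b - a) := by ring
  refine (LipschitzOnWith.of_dist_le' (K := (f m / m + 1) / m) ?_).continuousOn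
  intro a ha b hb
  rw [Real.dist_eq, Real.dist_eq]
  rcases le_total a b with hab | hab
  · rw [abs_sub_comm a b, abs_of_nonneg (sub_nonneg.2 hab)]
    exact key a ha b hb hab
  · rw [abs_sub_comm, abs_of_nonneg (sub_nonneg.2 hab)]
    exact key b hb a ha hab

/-- If a reflected maxmin copula is also a lower semilinear copula (with diagonal `δ`),
then it is the product copula. -/
theorem rmm_semilinear_is_product (f g : ℝ → ℝ) (h : CondG f g)
    (C : ℝ → ℝ → ℝ) (hC : ∀ u v : ℝ, C u v = max 0 (u * v - f u * g v))
    (δ : ℝ → ℝ) (hδrange : ∀ t ∈ Set.Icc (0:ℝ) 1, δ t ∈ Set.Icc (0:ℝ) 1)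
    (hlow : ∀ x y : ℝ, 0 < y → y ≤ x → x ≤ 1 → C x y = y * δ x / x)
    (hup : ∀ x y : ℝ, 0 < x → x ≤ y → y ≤ 1 → C x y = x * δ y / y) :
    ∀ u ∈ Set.Icc (0:ℝ) 1, ∀ v ∈ Set.Icc (0:ℝ) 1, C u v = u * v := by
  obtain ⟨hf, hg, hf0, hg0, hf1, hg1, hfm, hgm, hfa, hga⟩ := h
  have hdiag : ∀ m ∈ Set.Ioc (0:ℝ) 1, f m / m * (g m / m) ≤ 0 := by
    intro m hm
    by_contra! hpos
    set P : ℝ := f m / m * (g m / m) with hP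
    obtain ⟨c, hc0, hc⟩ := exists_between (lt_min hpos one_pos)
    obtain ⟨hcP, hc1⟩ := lt_min_iff.1 hc
    have hcont : ContinuousOn (fun u => f u / u * (g u / u)) (Set.Icc m 1) :=
      (continuousOn_div_self_of_monotone_antitone hm.1 hf hfm hfa).mul
        (continuousOn_div_self_of_monotone_antitone hm.1 hg hgm hga)
    obtain ⟨t, ht, htc⟩ := intermediate_value_Icc' hm.2 hcont
      (show c ∈ Set.Icc _ _ from ⟨by simp [hf1, hc0.le], hcP.le⟩)
    have hm0 := hm.1
    have ht0 : 0 < t := hm0.trans_le ht.1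
    have hfg : f t * g t = c * (t * t) := by
      simp only at htc
      rw [← htc]
      field_simp
    have hδ : δ t = (1 - c) * (t * t) := by
      have h1 := hlow t t ht0 le_rfl ht.2
      rw [mul_div_cancel_left₀ _ ht0.ne', hC, hfg, max_eq_right] at h1
      · linarith
      · nlinarith [mul_pos ht0 ht0]
    have hpos' : 0 < (1 - c) * (m * t) := mul_pos (by linarith) (mul_pos hm0 ht0)
    have hδ' : m * δ t / t = (1 - c) * (m * t) := by
      rw [hδ]
      field_simp
    have of_max : ∀ z : ℝ, max 0 z = (1 - c) * (m * t) → z = (1 - c) * (m * t) := by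
      intro z hz
      rcases max_choice 0 z with h | h <;> linarith
    have h1 : f t * g m = c * (m * t) := by
      have := of_max _ ((hC t m).symm.trans ((hlow t m hm0 ht.1 ht.2).trans hδ'))
      linarith
    have h2 : f m * g t = c * (m * t) := by
      have := of_max _ ((hC m t).symm.trans ((hup m t hm0 ht.1 ht.2).trans hδ'))
      linarith
    have h3 : c * (t * t) * (f m * g m) = c * (t * t) * (c * (m * m)) := by
      rw [← hfg]
      linear_combination f m * g t * h1 + c * (m * t) * h2 - c * (m * m) * hfg
    have h4 : f m * g m = c * (m * m) := mul_left_cancel₀ (by positivity) h3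
    have : P = c := by
      rw [hP, div_mul_div_comm, h4]
      field_simp
    linarith
  intro u hu v hv
  rw [hC]
  suffices hz : f u * g v = 0 by
    rw [hz, sub_zero, max_eq_right (mul_nonneg hu.1 hv.1)]
  rcases hu.1.eq_or_lt with rfl | hu0
  · simp [hf0]
  rcases hv.1.eq_or_lt with rfl | hv0
  · simp [hg0]
  have hm : min u v ∈ Set.Ioc (0:ℝ) 1 := ⟨lt_min hu0 hv0, (min_le_left _ _).trans hu.2⟩
  have h1 := hfa _ hm u ⟨hu0, hu.2⟩ (min_le_left _ _)
  have h2 := hga _ hm v ⟨hv0, hv.2⟩ (min_le_right _ _)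
  have hfu := hf u hu
  have hgv := hg v hv
  have h3 : f u / u * (g v / v) ≤ 0 :=
    (mul_le_mul h1 h2 (by positivity) ((div_nonneg hfu hu0.le).trans h1)).trans
      (hdiag _ hm)
  have h4 : f u * g v = f u / u * (g v / v) * (u * v) := by field_simp
  refine le_antisymm ?_ (mul_nonneg hfu hgv)
  rw [h4]
  exact mul_nonpos_of_nonpos_of_nonneg h3 (by positivity)
end

section
/- Let f : [0,1] → ℝ be nonnegative with u ↦ f(u) + u nondecreasing on [0,1] and u ↦ f(u)/u nonincreasing on (0,1]. Then for every ε ∈ (0,1], f is Lipschitz on the interval [ε,1] with Lipschitz constant max{1, f(ε)/ε}; that is, |f(x₂) − f(x₁)| ≤ max{1, f(ε)/ε}·|x₂ − x₁| for all x₁, x₂ ∈ [ε,1]. In particular, each generator of a reflected maxmin copula is absolutely continuous on [ε,1] for every ε > 0. -/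
/-- A generator of a reflected maxmin copula (nonnegative, with `u ↦ f u + u`
nondecreasing on `[0,1]` and `u ↦ f u / u` nonincreasing on `(0,1]`) is Lipschitz
on `[ε,1]` with constant `max 1 (f ε / ε)`, for every `ε ∈ (0,1]`; in particular it is
absolutely continuous on every such interval. -/
theorem rmm_generator_lipschitz (f : ℝ → ℝ)
    (hnonneg : ∀ u ∈ Set.Icc (0:ℝ) 1, 0 ≤ f u)
    (hmono : ∀ u₁ ∈ Set.Icc (0:ℝ) 1, ∀ u₂ ∈ Set.Icc (0:ℝ) 1,
      u₁ ≤ u₂ → f u₁ + u₁ ≤ f u₂ + u₂)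
    (hstar : ∀ u₁ ∈ Set.Ioc (0:ℝ) 1, ∀ u₂ ∈ Set.Ioc (0:ℝ) 1,
      u₁ ≤ u₂ → f u₂ / u₂ ≤ f u₁ / u₁)
    (ε : ℝ) (hε : 0 < ε) (hε1 : ε ≤ 1) :
    ∀ x₁ ∈ Set.Icc ε 1, ∀ x₂ ∈ Set.Icc ε 1,
      |f x₂ - f x₁| ≤ max 1 (f ε / ε) * |x₂ - x₁| := by
  have key : ∀ x y, ε ≤ x → x ≤ y → y ≤ 1 →
      |f y - f x| ≤ max 1 (f ε / ε) * (y - x) := by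
    intro x y hx hxy hy
    have hx0 : 0 < x := hε.trans_le hx
    have hy0 : 0 < y := hx0.trans_le hxy
    have hd : 0 ≤ y - x := sub_nonneg.2 hxy
    have hlower := hmono x ⟨hx0.le, hxy.trans hy⟩ y ⟨hy0.le, hy⟩ hxy
    have hratio := hstar x ⟨hx0, hxy.trans hy⟩ y ⟨hy0, hy⟩ hxy
    have hratio_ε := hstar ε ⟨hε, hε1⟩ x ⟨hx0, hxy.trans hy⟩ hx
    have hupper : f y ≤ f x / x * y := (div_le_iff₀ hy0).1 hratio
    have hfx : f x / x * x = f x := div_mul_cancel₀ _ hx0.ne'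
    have hone := mul_le_mul_of_nonneg_right (le_max_left 1 (f ε / ε)) hd
    have hslope := mul_le_mul_of_nonneg_right
      (hratio_ε.trans (le_max_right 1 (f ε / ε))) hd
    rw [mul_sub (f x / x)] at hslope
    rw [abs_le]
    constructor <;> linarith
  intro x₁ h₁ x₂ h₂
  rcases le_total x₁ x₂ with h | h
  · rw [abs_of_nonneg (sub_nonneg.2 h)]
    exact key x₁ x₂ h₁.1 h h₂.2
  · rw [abs_sub_comm (f x₂), abs_sub_comm x₂, abs_of_nonneg (sub_nonneg.2 h)]
    exact key x₂ x₁ h₂.1 h h₁.2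
end

section
/- Let f, g : [0,1] → ℝ be a pair satisfying conditions (G1)–(G3). Let u, v ∈ (0,1) be points such that f is differentiable at u with derivative f′(u), g is differentiable at v with derivative g′(v), and f(u)g(v) ≤ uv. Then f′(u)·g′(v) ≤ 1. -/
/-- If `x ↦ f x + x` is monotone on an open interval, then `f' ≥ -1` there. -/
lemma HasDerivAt.neg_one_le_of_monotoneOn_add_id {f : ℝ → ℝ} {f' a b x : ℝ}
    (hf : HasDerivAt f f' x) (hx : x ∈ Set.Ioo a b)
    (hmono : MonotoneOn (fun y ↦ f y + y) (Set.Ioo a b)) : -1 ≤ f' := by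
  have := (hf.add (hasDerivAt_id x)).hasDerivWithinAt.nonneg_of_monotoneOn
    (isOpen_Ioo.uniqueDiffWithinAt (𝕜 := ℝ) hx).accPt hmono
  linarith

/-- If `x ↦ f x / x` is antitone on an open interval of positive reals, then `f' x ≤ f x / x`
there. -/
lemma HasDerivAt.le_div_of_antitoneOn_div_id {f : ℝ → ℝ} {f' a b x : ℝ}
    (hf : HasDerivAt f f' x) (ha : 0 ≤ a) (hx : x ∈ Set.Ioo a b)
    (hanti : AntitoneOn (fun y ↦ f y / y) (Set.Ioo a b)) : f' ≤ f x / x := by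
  have hx0 : 0 < x := ha.trans_lt hx.1
  have := (hf.div (hasDerivAt_id x) hx0.ne').hasDerivWithinAt.nonpos_of_antitoneOn
    (isOpen_Ioo.uniqueDiffWithinAt (𝕜 := ℝ) hx).accPt hanti
  rw [div_le_iff₀ (by simpa using pow_pos hx0 2), id_eq] at this
  rw [le_div_iff₀ hx0]
  linarith

/-- If `s ∈ [-1, a]` and `t ∈ [-1, b]` with `a, b ≥ 0` and `a * b ≤ 1`, then `s * t ≤ 1`. -/
lemma mul_le_one_of_neg_one_le_of_le {s t a b : ℝ} (hs : -1 ≤ s) (ht : -1 ≤ t)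
    (hsa : s ≤ a) (htb : t ≤ b) (ha : 0 ≤ a) (hab : a * b ≤ 1) : s * t ≤ 1 := by
  rcases le_total 0 s with h0s | h0s <;> rcases le_total 0 t with h0t | h0t
  · exact (mul_le_mul hsa htb h0t ha).trans hab
  all_goals nlinarith

/-- If `(f, g)` satisfies (G1)–(G3), `u, v ∈ (0,1)`, `f` is differentiable at `u`,
`g` is differentiable at `v`, and `f u * g v ≤ u * v`, then `f' u * g' v ≤ 1`. -/
theorem rmm_derivative_product_le_one (f g : ℝ → ℝ) (h : CondG f g)
    (u v : ℝ) (hu : u ∈ Set.Ioo (0:ℝ) 1) (hv : v ∈ Set.Ioo (0:ℝ) 1)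
    (fu gv : ℝ) (hfu : HasDerivAt f fu u) (hgv : HasDerivAt g gv v)
    (hle : f u * g v ≤ u * v) :
    fu * gv ≤ 1 := by
  obtain ⟨hf0, -, -, -, -, -, hfm, hgm, hfa, hga⟩ := h
  have hIcc : Set.Ioo (0 : ℝ) 1 ⊆ Set.Icc 0 1 := Set.Ioo_subset_Icc_self
  have hIoc : Set.Ioo (0 : ℝ) 1 ⊆ Set.Ioc 0 1 := Set.Ioo_subset_Ioc_self
  refine mul_le_one_of_neg_one_le_of_le
    (hfu.neg_one_le_of_monotoneOn_add_id hu
      fun x hx y hy hxy ↦ hfm x (hIcc hx) y (hIcc hy) hxy)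
    (hgv.neg_one_le_of_monotoneOn_add_id hv
      fun x hx y hy hxy ↦ hgm x (hIcc hx) y (hIcc hy) hxy)
    (hfu.le_div_of_antitoneOn_div_id le_rfl hu
      fun x hx y hy hxy ↦ hfa x (hIoc hx) y (hIoc hy) hxy)
    (hgv.le_div_of_antitoneOn_div_id le_rfl hv
      fun x hx y hy hxy ↦ hga x (hIoc hx) y (hIoc hy) hxy)
    (div_nonneg (hf0 u (hIcc hu)) hu.1.le) ?_
  rw [div_mul_div_comm]
  exact div_le_one_of_le₀ hle (mul_pos hu.1 hv.1).le
end

section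
/- Let f, g : [0,1] → ℝ be a pair satisfying conditions (G1)–(G3). Suppose 0 ≤ x₁ ≤ x₂ ≤ 1 and 0 ≤ y₁ ≤ y₂ ≤ 1 are such that f(x₁)g(y₁) < x₁y₁. Then (f(x₂) − f(x₁))·(g(y₂) − g(y₁)) ≤ (x₂ − x₁)·(y₂ − y₁). -/
/-- If `(f, g)` satisfies (G1)–(G3) and `f x₁ * g y₁ < x₁ * y₁` with
`0 ≤ x₁ ≤ x₂ ≤ 1`, `0 ≤ y₁ ≤ y₂ ≤ 1`, then
`(f x₂ - f x₁) * (g y₂ - g y₁) ≤ (x₂ - x₁) * (y₂ - y₁)`. -/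
theorem rmm_difference_quotient_bound (f g : ℝ → ℝ) (h : CondG f g)
    (x₁ x₂ y₁ y₂ : ℝ)
    (hx₁ : 0 ≤ x₁) (hx : x₁ ≤ x₂) (hx₂ : x₂ ≤ 1)
    (hy₁ : 0 ≤ y₁) (hy : y₁ ≤ y₂) (hy₂ : y₂ ≤ 1)
    (hstand : f x₁ * g y₁ < x₁ * y₁) :
    (f x₂ - f x₁) * (g y₂ - g y₁) ≤ (x₂ - x₁) * (y₂ - y₁) := by
  obtain ⟨hf, -, hf0, hg0, -, -, hfm, hgm, hfa, hga⟩ := h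
  have hx₁pos : 0 < x₁ := by
    rcases hx₁.eq_or_lt with rfl | hpos
    · simp [hf0] at hstand
    · exact hpos
  have hy₁pos : 0 < y₁ := by
    rcases hy₁.eq_or_lt with rfl | hpos
    · simp [hg0] at hstand
    · exact hpos
  have hfx := hfm x₁ ⟨hx₁, hx.trans hx₂⟩ x₂ ⟨hx₁.trans hx, hx₂⟩ hx
  have hgy := hgm y₁ ⟨hy₁, hy.trans hy₂⟩ y₂ ⟨hy₁.trans hy, hy₂⟩ hy
  have hfd := hfa x₁ ⟨hx₁pos, hx.trans hx₂⟩ x₂ ⟨hx₁pos.trans_le hx, hx₂⟩ hx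
  have hgd := hga y₁ ⟨hy₁pos, hy.trans hy₂⟩ y₂ ⟨hy₁pos.trans_le hy, hy₂⟩ hy
  rw [div_le_div_iff₀ (hx₁pos.trans_le hx) hx₁pos] at hfd
  rw [div_le_div_iff₀ (hy₁pos.trans_le hy) hy₁pos] at hgd
  have hdx : 0 ≤ x₂ - x₁ := sub_nonneg.2 hx
  have hdy : 0 ≤ y₂ - y₁ := sub_nonneg.2 hy
  have hprod : 0 ≤ (x₂ - x₁) * (y₂ - y₁) := mul_nonneg hdx hdy
  rcases le_total 0 (f x₂ - f x₁) with hF | hF <;>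
    rcases le_total 0 (g y₂ - g y₁) with hG | hG
  · have hfc : x₁ * (f x₂ - f x₁) ≤ f x₁ * (x₂ - x₁) := by linarith
    have hgc : y₁ * (g y₂ - g y₁) ≤ g y₁ * (y₂ - y₁) := by linarith
    refine le_of_mul_le_mul_left ?_ (mul_pos hx₁pos hy₁pos)
    calc x₁ * y₁ * ((f x₂ - f x₁) * (g y₂ - g y₁))
        = x₁ * (f x₂ - f x₁) * (y₁ * (g y₂ - g y₁)) := by ring
      _ ≤ f x₁ * (x₂ - x₁) * (g y₁ * (y₂ - y₁)) :=
          mul_le_mul hfc hgc (mul_nonneg hy₁ hG)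
            (mul_nonneg (hf x₁ ⟨hx₁, hx.trans hx₂⟩) hdx)
      _ = f x₁ * g y₁ * ((x₂ - x₁) * (y₂ - y₁)) := by ring
      _ ≤ x₁ * y₁ * ((x₂ - x₁) * (y₂ - y₁)) :=
          mul_le_mul_of_nonneg_right hstand.le hprod
  · exact (mul_nonpos_of_nonneg_of_nonpos hF hG).trans hprod
  · exact (mul_nonpos_of_nonpos_of_nonneg hF hG).trans hprod
  · rw [← neg_mul_neg]
    exact mul_le_mul (by linarith) (by linarith) (neg_nonneg.2 hG) hdx
end

section
/- Let δ : [0,1] → ℝ be a diagonal function (i.e. δ(0) = 0, δ(1) = 1, δ(t) ≤ t for all t, δ is nondecreasing, and |δ(s) − δ(t)| ≤ 2|s − t| for all s, t) satisfying in addition δ(t) ≤ t² for all t ∈ [0,1], with t ↦ δ(t)/t² nondecreasing on (0,1] and t ↦ t + √(t² − δ(t)) nondecreasing on [0,1]. Define f(t) = √(t² − δ(t)) for t ∈ [0,1]. Then the pair (f, f) satisfies conditions (G1)–(G3), and the SRMM copula C_f(u,v) = max{0, uv − f(u)f(v)} has diagonal section δ, i.e. max{0, t² − f(t)²} = δ(t)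 for all t ∈ [0,1]. -/
/-- `t ↦ √(t² - y) / t` is `√(1 - y / t²)` for positive `t`. -/
theorem sqrt_sq_sub_div_self {t : ℝ} (ht : 0 < t) (y : ℝ) :
    √(t ^ 2 - y) / t = √(1 - y / t ^ 2) := by
  have h : 1 - y / t ^ 2 = (t ^ 2 - y) / t ^ 2 := by field_simp
  rw [h, Real.sqrt_div' _ (sq_nonneg t), Real.sqrt_sq ht.le]

/-- If `δ` is a diagonal function with `δ t ≤ t²`, `t ↦ δ t / t²` nondecreasing on
`(0,1]` and `t ↦ t + √(t² - δ t)` nondecreasing on `[0,1]`, then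
`f t = √(t² - δ t)` generates an SRMM copula whose diagonal section is `δ`. -/
theorem srmm_from_diagonal (δ : ℝ → ℝ)
    (hδ0 : δ 0 = 0) (hδ1 : δ 1 = 1)
    (hδle : ∀ t ∈ Set.Icc (0:ℝ) 1, δ t ≤ t)
    (hδmono : ∀ s ∈ Set.Icc (0:ℝ) 1, ∀ t ∈ Set.Icc (0:ℝ) 1, s ≤ t → δ s ≤ δ t)
    (hδlip : ∀ s ∈ Set.Icc (0:ℝ) 1, ∀ t ∈ Set.Icc (0:ℝ) 1, |δ s - δ t| ≤ 2 * |s - t|)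
    (hδsq : ∀ t ∈ Set.Icc (0:ℝ) 1, δ t ≤ t ^ 2)
    (hsharp : ∀ t₁ ∈ Set.Ioc (0:ℝ) 1, ∀ t₂ ∈ Set.Ioc (0:ℝ) 1, t₁ ≤ t₂ →
      δ t₁ / t₁ ^ 2 ≤ δ t₂ / t₂ ^ 2)
    (hhat : ∀ t₁ ∈ Set.Icc (0:ℝ) 1, ∀ t₂ ∈ Set.Icc (0:ℝ) 1, t₁ ≤ t₂ →
      t₁ + Real.sqrt (t₁ ^ 2 - δ t₁) ≤ t₂ + Real.sqrt (t₂ ^ 2 - δ t₂))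
    (f : ℝ → ℝ) (hf : ∀ t : ℝ, f t = Real.sqrt (t ^ 2 - δ t)) :
    CondG f f ∧ ∀ t ∈ Set.Icc (0:ℝ) 1, max 0 (t ^ 2 - f t ^ 2) = δ t := by
  have hnonneg : ∀ u ∈ Set.Icc (0:ℝ) 1, 0 ≤ f u := fun u _ => hf u ▸ Real.sqrt_nonneg _
  have hzero : f 0 = 0 := by simp [hf, hδ0]
  have hone : f 1 = 0 := by simp [hf, hδ1]
  have hadd : ∀ u₁ ∈ Set.Icc (0:ℝ) 1, ∀ u₂ ∈ Set.Icc (0:ℝ) 1, u₁ ≤ u₂ →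
      f u₁ + u₁ ≤ f u₂ + u₂ := by
    intro u₁ h₁ u₂ h₂ h
    rw [hf, hf, add_comm _ u₁, add_comm _ u₂]
    exact hhat u₁ h₁ u₂ h₂ h
  have hdiv : ∀ u₁ ∈ Set.Ioc (0:ℝ) 1, ∀ u₂ ∈ Set.Ioc (0:ℝ) 1, u₁ ≤ u₂ →
      f u₂ / u₂ ≤ f u₁ / u₁ := by
    intro u₁ h₁ u₂ h₂ h
    rw [hf, hf, sqrt_sq_sub_div_self h₁.1, sqrt_sq_sub_div_self h₂.1]
    exact Real.sqrt_le_sqrt (sub_le_sub_left (hsharp u₁ h₁ u₂ h₂ h) 1)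
  refine ⟨⟨hnonneg, hnonneg, hzero, hzero, hone, hone, hadd, hadd, hdiv, hdiv⟩, fun t ht => ?_⟩
  have hδt : 0 ≤ δ t := hδ0 ▸ hδmono 0 (by simp) t ht ht.1
  rw [hf, Real.sq_sqrt (sub_nonneg.2 (hδsq t ht)), sub_sub_cancel, max_eq_right hδt]
end

section
/- Let δ : [0,1] → ℝ satisfy 0 ≤ δ(t) ≤ t² for all t, and suppose δ(t) > 0 for all t ∈ (0,1]. Let f(t) = √(t² − δ(t)). If g : [0,1] → ℝ is any function such that the pair (g, g) satisfies conditions (G1)–(G3) and max{0, t² − g(t)²} = δ(t) for all t ∈ [0,1], then g(t) = f(t) for all t ∈ [0,1]. In particular, an SRMM copula whose diagonal section is strictly positive on (0,1] is uniquely determined by its diagonal section. -/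
/-- If `δ` satisfies `0 ≤ δ t ≤ t²` and `δ t > 0` on `(0,1]`, then an SRMM copula with
diagonal section `δ` has a uniquely determined generator, namely `g t = √(t² - δ t)`. -/
theorem srmm_unique_generator_of_positive_diagonal (δ : ℝ → ℝ)
    (hδ0 : ∀ t ∈ Set.Icc (0:ℝ) 1, 0 ≤ δ t)
    (hδsq : ∀ t ∈ Set.Icc (0:ℝ) 1, δ t ≤ t ^ 2)
    (hδpos : ∀ t ∈ Set.Ioc (0:ℝ) 1, 0 < δ t)
    (g : ℝ → ℝ) (hg : CondG g g)
    (hdiag : ∀ t ∈ Set.Icc (0:ℝ) 1, max 0 (t ^ 2 - g t ^ 2) = δ t) :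
    ∀ t ∈ Set.Icc (0:ℝ) 1, g t = Real.sqrt (t ^ 2 - δ t) := by
  obtain ⟨hnn, -, h0, -⟩ := hg
  intro t ht
  suffices h : t ^ 2 - δ t = g t ^ 2 by rw [h, Real.sqrt_sq (hnn t ht)]
  rcases ht.1.eq_or_lt with rfl | hpos
  · have hδ : δ 0 = 0 := le_antisymm (by simpa using hδsq 0 ht) (hδ0 0 ht)
    simp [hδ, h0]
  · have hδt := hδpos t ⟨hpos, ht.2⟩
    have hd := hdiag t ht
    rcases max_choice 0 (t ^ 2 - g t ^ 2) with h | h <;> linarith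
end

section
/- Let (f₁, g₁) and (f₂, g₂) be two pairs of functions [0,1] → ℝ, each satisfying conditions (G1)–(G3), and suppose max{0, uv − f₁(u)g₁(v)} = max{0, uv − f₂(u)g₂(v)} for all u, v ∈ [0,1], while this common copula is not the product copula (i.e. it is not identically equal to uv on [0,1]²). Then there exists λ > 0 such that f₂(u) = λ·f₁(u) and g₂(v) = λ⁻¹·g₁(v) for all u, v ∈ [0,1]. In particular, the generator of a symmetric RMM copula distinct from the product copula is uniquely determined by the copula. -/
/-- A function that vanishes at `1` and satisfies (G2) takes, if it is positive somewhere,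
positive values that are arbitrarily small relative to the argument. -/
theorem exists_pos_lt_mul_of_add_id_monotone {h : ℝ → ℝ} (h_one : h 1 = 0)
    (hmono : ∀ x ∈ Set.Icc (0:ℝ) 1, ∀ y ∈ Set.Icc (0:ℝ) 1, x ≤ y → h x + x ≤ h y + y)
    {a : ℝ} (ha : a ∈ Set.Ioc (0:ℝ) 1) (hpos : 0 < h a) {ε : ℝ} (hε : 0 < ε) :
    ∃ x ∈ Set.Ioc (0:ℝ) 1, 0 < h x ∧ h x < ε * x := by
  by_contra! hcon
  set S : Set ℝ := {x | x ∈ Set.Icc a 1 ∧ 0 < h x}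
  have haS : a ∈ S := ⟨⟨le_rfl, ha.2⟩, hpos⟩
  have hbdd : BddAbove S := ⟨1, fun x hx => hx.1.2⟩
  have hc : 0 < ε * a := mul_pos hε ha.1
  obtain ⟨x, ⟨⟨hax, hx1⟩, hx⟩, hlt⟩ :=
    exists_lt_of_lt_csSup ⟨a, haS⟩ (sub_lt_self (sSup S) (half_pos hc))
  have hx0 : 0 < x := ha.1.trans_le hax
  have hlow : ε * a ≤ h x :=
    (mul_le_mul_of_nonneg_left hax hε.le).trans (hcon x ⟨hx0, hx1⟩ hx)
  rcases le_total (x + ε * a / 2) 1 with hle | hle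
  · have hstep := hmono x ⟨hx0.le, hx1⟩ (x + ε * a / 2) ⟨by linarith, hle⟩ (by linarith)
    have hsup : x + ε * a / 2 ≤ sSup S :=
      le_csSup hbdd ⟨⟨by linarith, hle⟩, by linarith⟩
    linarith
  · have hstep := hmono x ⟨hx0.le, hx1⟩ 1 ⟨zero_le_one, le_rfl⟩ hx1
    linarith

/-- If `max 0 (a - x) = max 0 (a - y)` and `x < a`, then `x = y`. -/
theorem eq_of_max_zero_sub_eq {a x y : ℝ} (h : max 0 (a - x) = max 0 (a - y)) (hx : x < a) :
    x = y := by
  grind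

/-- Two pairs of generators producing the same RMM copula, distinct from the product
copula, differ only by a multiplicative constant: `f₂ = λ f₁` and `g₂ = λ⁻¹ g₁`. -/
theorem rmm_generators_unique_up_to_constant (f₁ g₁ f₂ g₂ : ℝ → ℝ)
    (h₁ : CondG f₁ g₁) (h₂ : CondG f₂ g₂)
    (heq : ∀ u ∈ Set.Icc (0:ℝ) 1, ∀ v ∈ Set.Icc (0:ℝ) 1,
      max 0 (u * v - f₁ u * g₁ v) = max 0 (u * v - f₂ u * g₂ v))
    (hne : ¬ ∀ u ∈ Set.Icc (0:ℝ) 1, ∀ v ∈ Set.Icc (0:ℝ) 1,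
      max 0 (u * v - f₁ u * g₁ v) = u * v) :
    ∃ l : ℝ, 0 < l ∧ (∀ u ∈ Set.Icc (0:ℝ) 1, f₂ u = l * f₁ u) ∧
      (∀ v ∈ Set.Icc (0:ℝ) 1, g₂ v = l⁻¹ * g₁ v) := by
  obtain ⟨hf₁, hg₁, hf₁0, hg₁0, hf₁1, hg₁1, hf₁m, hg₁m, -, -⟩ := h₁
  obtain ⟨hf₂, hg₂, hf₂0, hg₂0, -⟩ := h₂
  have hmul : ∀ u ∈ Set.Icc (0:ℝ) 1, ∀ v ∈ Set.Icc (0:ℝ) 1, f₁ u * g₁ v < u * v →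
      f₁ u * g₁ v = f₂ u * g₂ v :=
    fun u hu v hv huv => eq_of_max_zero_sub_eq (heq u hu v hv) huv
  have pos_of_apply_pos : ∀ {h : ℝ → ℝ}, h 0 = 0 → ∀ x ∈ Set.Icc (0:ℝ) 1, 0 < h x →
      x ∈ Set.Ioc (0:ℝ) 1 := by
    intro h h0 x hx hpos
    refine ⟨hx.1.lt_of_ne ?_, hx.2⟩
    rintro rfl
    exact hpos.ne' h0
  obtain ⟨a, ha, b, hb, hab⟩ : ∃ a ∈ Set.Icc (0:ℝ) 1, ∃ b ∈ Set.Icc (0:ℝ) 1,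
      f₁ a * g₁ b ≠ 0 := by
    by_contra! hzero
    refine hne fun u hu v hv => ?_
    rw [hzero u hu v hv, sub_zero, max_eq_right (mul_nonneg hu.1 hv.1)]
  have hfa : 0 < f₁ a := (hf₁ a ha).lt_of_ne' (left_ne_zero_of_mul hab)
  have hgb : 0 < g₁ b := (hg₁ b hb).lt_of_ne' (right_ne_zero_of_mul hab)
  have ha' := pos_of_apply_pos hf₁0 a ha hfa
  have hb' := pos_of_apply_pos hg₁0 b hb hgb
  have small : ∀ {h : ℝ → ℝ} {c t : ℝ}, h 1 = 0 →
      (∀ x ∈ Set.Icc (0:ℝ) 1, ∀ y ∈ Set.Icc (0:ℝ) 1, x ≤ y → h x + x ≤ h y + y) →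
      c ∈ Set.Ioc (0:ℝ) 1 → 0 < h c → 0 < t → ∀ M, 0 ≤ M →
      ∃ x ∈ Set.Icc (0:ℝ) 1, 0 < h x ∧ ∀ m ≤ M, m * h x < t * x := by
    intro h c t h_one hmono hc hpos ht M hM
    obtain ⟨x, hx, hxpos, hlt⟩ := exists_pos_lt_mul_of_add_id_monotone h_one hmono hc hpos
      (div_pos ht (by linarith : 0 < M + 1))
    refine ⟨x, Set.Ioc_subset_Icc_self hx, hxpos, fun m hm => ?_⟩
    rw [div_mul_eq_mul_div, lt_div_iff₀ (by linarith)] at hlt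
    nlinarith
  have cross : ∀ u ∈ Set.Ioc (0:ℝ) 1, 0 < f₂ a ∧ f₂ u * f₁ a = f₂ a * f₁ u := by
    intro u hu
    have hu' := Set.Ioc_subset_Icc_self hu
    obtain ⟨v, hv, hvpos, hlt⟩ := small hg₁1 hg₁m hb' hgb (lt_min hu.1 ha'.1)
      (max (f₁ u) (f₁ a)) ((hf₁ u hu').trans (le_max_left _ _))
    have h1 := hmul u hu' v hv ((hlt _ (le_max_left _ _)).trans_le
      (mul_le_mul_of_nonneg_right (min_le_left _ _) hv.1))
    have h2 := hmul a ha v hv ((hlt _ (le_max_right _ _)).trans_le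
      (mul_le_mul_of_nonneg_right (min_le_right _ _) hv.1))
    have hprod : 0 < f₂ a * g₂ v := h2 ▸ mul_pos hfa hvpos
    have hg₂v : 0 < g₂ v := pos_of_mul_pos_right hprod (hf₂ a ha)
    refine ⟨pos_of_mul_pos_left hprod hg₂v.le, mul_right_cancel₀ hg₂v.ne' ?_⟩
    linear_combination f₁ u * h2 - f₁ a * h1
  have hf₂a : 0 < f₂ a := (cross a ha').1
  have hl : 0 < f₂ a / f₁ a := div_pos hf₂a hfa
  have hf : ∀ u ∈ Set.Icc (0:ℝ) 1, f₂ u = f₂ a / f₁ a * f₁ u := by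
    intro u hu
    rcases hu.1.eq_or_lt with rfl | hu0
    · rw [hf₁0, hf₂0, mul_zero]
    · rw [div_mul_eq_mul_div, eq_div_iff hfa.ne']
      exact (cross u ⟨hu0, hu.2⟩).2
  refine ⟨f₂ a / f₁ a, hl, hf, fun v hv => ?_⟩
  rcases hv.1.eq_or_lt with rfl | hv0
  · rw [hg₁0, hg₂0, mul_zero]
  · obtain ⟨u, hu, hupos, hlt⟩ := small hf₁1 hf₁m ha' hfa hv0 (g₁ v) (hg₁ v hv)
    have h1 := hmul u hu v hv (by linarith [hlt _ le_rfl, mul_comm (g₁ v) (f₁ u), mul_comm u v])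
    rw [hf u hu] at h1
    rw [eq_inv_mul_iff_mul_eq₀ hl.ne']
    refine mul_left_cancel₀ hupos.ne' ?_
    linear_combination -h1
end

section
/- Let f : [0,1] → ℝ be such that the pair (f, f) satisfies conditions (G1)–(G3), and let C_f(u,v) = max{0, uv − f(u)f(v)}. Suppose u₀ ∈ (0,1] satisfies f(u₀) = u₀. Let u ∈ [u₀,1] and v ∈ (0,1] be such that f(v) > 0 and f(u₀)f(v) ≤ u₀v. Then u₀v − C_f(u₀,v) > 0 and f(u) = u₀ · (uv − C_f(u,v)) / (u₀v − C_f(u₀,v)). In particular, the generator of an SRMM copula can be recovered in closed form from the copula via the quotient Q_C(u,v;u₀,v) = (uv − C(u,v))/(u₀v − C(u₀,v)), independently of the choice of v. -/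
/-- Recovery of the generator of an SRMM copula in closed form: if `f u₀ = u₀` for some
`u₀ ∈ (0,1]`, `u ∈ [u₀,1]`, `v ∈ (0,1]` with `f v > 0` and `f u₀ * f v ≤ u₀ * v`, then
`Δ_C(u₀,v) = u₀ * v - C u₀ v > 0` and
`f u = u₀ * ((u * v - C u v) / (u₀ * v - C u₀ v))`. -/
theorem srmm_generator_closed_form (f : ℝ → ℝ) (h : CondG f f)
    (C : ℝ → ℝ → ℝ) (hC : ∀ u v : ℝ, C u v = max 0 (u * v - f u * f v))
    (u₀ : ℝ) (hu₀ : u₀ ∈ Set.Ioc (0:ℝ) 1) (hfix : f u₀ = u₀)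
    (u : ℝ) (hu : u ∈ Set.Icc u₀ 1)
    (v : ℝ) (hv : v ∈ Set.Ioc (0:ℝ) 1) (hfv : 0 < f v)
    (hle : f u₀ * f v ≤ u₀ * v) :
    0 < u₀ * v - C u₀ v ∧
    f u = u₀ * ((u * v - C u v) / (u₀ * v - C u₀ v)) := by
  obtain ⟨-, -, -, -, -, -, -, -, hratio, -⟩ := h
  have h0 : 0 < u₀ := hu₀.1
  have hu_pos : 0 < u := h0.trans_le hu.1
  have hv_le : f v ≤ v := by
    rw [hfix] at hle
    exact le_of_mul_le_mul_left hle h0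
  have hu_le : f u ≤ u := by
    have hdiv := hratio u₀ hu₀ u ⟨hu_pos, hu.2⟩ hu.1
    rwa [hfix, div_self h0.ne', div_le_one hu_pos] at hdiv
  have hmul : f u * f v ≤ u * v := mul_le_mul hu_le hv_le hfv.le hu_pos.le
  rw [hC, hC, max_eq_right (sub_nonneg.2 hle), max_eq_right (sub_nonneg.2 hmul),
    sub_sub_cancel, sub_sub_cancel, hfix]
  refine ⟨mul_pos h0 hfv, ?_⟩
  field_simp
end
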